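/- Let A = {mean, sum} or A = {mean, max}. There is a constant C (independent of the formula) such that for every PML formula φ of modal depth at most 1 in which only the modalities E_in and E_out occur (φ ∈ PML₁^E), there exist an MPNN M_φ ∈ M_A with at most C·(deg(φ)+1) layers and a natural number e ≤ C·(deg(φ)+1) such that M_φ recognises φ over the class of all pointed graphs (G,v) whose focus v is strongly marked by colour p, with certainty c(|V|) = 1/|V|^e. -/

import Mathlib

namespace PMLMPNN

/-- Modalities of Peano modal logic. -/
inductive Modality where
  | id | ein | eout | top
deriving DecidableEq

/-- A normalised integer inequality `∑ i, a i * ∏ (mon i) ≤ b`. -/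
structure PeanoIneq (m : ℕ) where
  K : ℕ
  a : Fin K → ℤ
  mon : Fin K → List (Fin m)
  b : ℤ

/-- Value of a monomial (a list of variables) under an assignment. -/
def monValZ {m : ℕ} (c : Fin m → ℕ) (l : List (Fin m)) : ℤ :=
  (l.map (fun j => (c j : ℤ))).prod

def PeanoIneq.sat {m : ℕ} (t : PeanoIneq m) (c : Fin m → ℕ) : Bool :=
  decide ((∑ i, t.a i * monValZ c (t.mon i)) ≤ t.b)

def PeanoIneq.deg {m : ℕ} (t : PeanoIneq m) : ℕ :=
  Finset.univ.sup (fun i => (t.mon i).length)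

/-- Peano formulas: Boolean combinations of normalised inequalities. -/
inductive PeanoFormula (m : ℕ) where
  | ineq : PeanoIneq m → PeanoFormula m
  | not : PeanoFormula m → PeanoFormula m
  | and : PeanoFormula m → PeanoFormula m → PeanoFormula m

def PeanoFormula.sat {m : ℕ} (c : Fin m → ℕ) : PeanoFormula m → Bool
  | .ineq t => t.sat c
  | .not ψ => ! ψ.sat c
  | .and ψ₁ ψ₂ => ψ₁.sat c && ψ₂.sat c

def PeanoFormula.deg {m : ℕ} : PeanoFormula m → ℕ
  | .ineq t => t.deg
  | .not ψ => ψ.deg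
  | .and ψ₁ ψ₂ => max ψ₁.deg ψ₂.deg

/-- A term is homogeneous if it has no constant part and all its monomials
have the same degree. -/
def PeanoIneq.Homog {m : ℕ} (t : PeanoIneq m) : Prop :=
  t.b = 0 ∧ ∀ i, (t.mon i).length = t.deg

def PeanoFormula.Homog {m : ℕ} : PeanoFormula m → Prop
  | .ineq t => t.Homog
  | .not ψ => ψ.Homog
  | .and ψ₁ ψ₂ => ψ₁.Homog ∧ ψ₂.Homog

/-- The set of monomials occurring in a Peano formula. -/
def PeanoFormula.mons {m : ℕ} : PeanoFormula m → Finset (List (Fin m))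
  | .ineq t => Finset.univ.image t.mon
  | .not ψ => ψ.mons
  | .and ψ₁ ψ₂ => ψ₁.mons ∪ ψ₂.mons

/-- The set of constants occurring in a Peano formula. -/
def PeanoFormula.consts {m : ℕ} : PeanoFormula m → Finset ℤ
  | .ineq t => {t.b}
  | .not ψ => ψ.consts
  | .and ψ₁ ψ₂ => ψ₁.consts ∪ ψ₂.consts

/-- PML formulas over `k` colours (propositions). -/
inductive PML (k : ℕ) where
  | prop : Fin k → PML k
  | not : PML k → PML k
  | and : PML k → PML k → PML k
  | modal : (m : ℕ) → (Fin m → Modality) → PeanoFormula m → (Fin m → PML k) → PML k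

def PML.md {k : ℕ} : PML k → ℕ
  | .prop _ => 0
  | .not φ => φ.md
  | .and φ₁ φ₂ => max φ₁.md φ₂.md
  | .modal _ _ _ φs => 1 + Finset.univ.sup (fun i => (φs i).md)

def PML.deg {k : ℕ} : PML k → ℕ
  | .prop _ => 0
  | .not φ => φ.deg
  | .and φ₁ φ₂ => max φ₁.deg φ₂.deg
  | .modal _ _ ψ φs => max ψ.deg (Finset.univ.sup (fun i => (φs i).deg))

def PML.onlyTop {k : ℕ} : PML k → Prop
  | .prop _ => True
  | .not φ => φ.onlyTop
  | .and φ₁ φ₂ => φ₁.onlyTop ∧ φ₂.onlyTop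
  | .modal _ π _ φs => (∀ i, π i = Modality.top) ∧ (∀ i, (φs i).onlyTop)

def PML.onlyE {k : ℕ} : PML k → Prop
  | .prop _ => True
  | .not φ => φ.onlyE
  | .and φ₁ φ₂ => φ₁.onlyE ∧ φ₂.onlyE
  | .modal _ π _ φs => (∀ i, π i = Modality.ein ∨ π i = Modality.eout) ∧ (∀ i, (φs i).onlyE)

/-- Propositional formulas: no modal subformula at all. -/
def PML.NoModal {k : ℕ} : PML k → Prop
  | .prop _ => True
  | .not φ => φ.NoModal
  | .and φ₁ φ₂ => φ₁.NoModal ∧ φ₂.NoModal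
  | .modal _ _ _ _ => False

/-- Subformula relation. -/
inductive PML.Sub {k : ℕ} : PML k → PML k → Prop where
  | refl (φ : PML k) : PML.Sub φ φ
  | not {χ φ : PML k} : PML.Sub χ φ → PML.Sub χ (.not φ)
  | and_left {χ φ₁ φ₂ : PML k} : PML.Sub χ φ₁ → PML.Sub χ (.and φ₁ φ₂)
  | and_right {χ φ₁ φ₂ : PML k} : PML.Sub χ φ₂ → PML.Sub χ (.and φ₁ φ₂)
  | modal {χ : PML k} {m : ℕ} {π : Fin m → Modality} {ψ : PeanoFormula m}
      {φs : Fin m → PML k} (i : Fin m) :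
      PML.Sub χ (φs i) → PML.Sub χ (.modal m π ψ φs)

/-- Finite directed node-labelled graphs with `k` colours; labels in `{0,1}^k`
are represented by Boolean vectors. -/
structure Graph (k : ℕ) where
  n : ℕ
  E : Finset (Fin n × Fin n)
  L : Fin n → Fin k → Bool

def Graph.neighIn {k : ℕ} (G : Graph k) (v : Fin G.n) : Finset (Fin G.n) :=
  Finset.univ.filter (fun u => (u, v) ∈ G.E)

def Graph.neighOut {k : ℕ} (G : Graph k) (v : Fin G.n) : Finset (Fin G.n) :=
  Finset.univ.filter (fun u => (v, u) ∈ G.E)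

def Graph.Regular {k : ℕ} (G : Graph k) : Prop :=
  ∀ u v : Fin G.n,
    (G.neighIn u).card = (G.neighIn v).card ∧ (G.neighOut u).card = (G.neighOut v).card

/-- `v` is marked by colour `p`. -/
def Graph.MarkedBy {k : ℕ} (G : Graph k) (v : Fin G.n) (p : Fin k) : Prop :=
  ∀ u : Fin G.n, G.L u p = true ↔ u = v

/-- `v` is strongly marked by colour `p`: marked and `v ∈ neigh(v)`. -/
def Graph.StronglyMarkedBy {k : ℕ} (G : Graph k) (v : Fin G.n) (p : Fin k) : Prop :=
  G.MarkedBy v p ∧ (v, v) ∈ G.E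

def Graph.modSem {k : ℕ} (G : Graph k) (v : Fin G.n) : Modality → Finset (Fin G.n)
  | .id => {v}
  | .ein => G.neighIn v
  | .eout => G.neighOut v
  | .top => Finset.univ

/-- Satisfaction of PML formulas on pointed graphs. -/
def PML.sat {k : ℕ} (G : Graph k) : PML k → Fin G.n → Bool
  | .prop i, v => G.L v i
  | .not φ, v => ! PML.sat G φ v
  | .and φ₁ φ₂, v => PML.sat G φ₁ v && PML.sat G φ₂ v
  | .modal _ π ψ φs, v =>
      ψ.sat (fun i => ((G.modSem v (π i)).filter (fun u => PML.sat G (φs i) u = true)).card)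

/-- Feedforward neural networks with ReLU activations and rational weights. -/
inductive FNN : ℕ → ℕ → Type where
  | layer {din dout : ℕ} (w : Fin dout → Fin din → ℚ) (b : Fin dout → ℚ) : FNN din dout
  | comp {d₁ d₂ d₃ : ℕ} : FNN d₁ d₂ → FNN d₂ d₃ → FNN d₁ d₃

def FNN.eval : {din dout : ℕ} → FNN din dout → (Fin din → ℚ) → Fin dout → ℚ
  | _, _, .layer w b, x => fun j => max 0 (b j + ∑ i, w j i * x i)
  | _, _, .comp f g, x => g.eval (f.eval x)

/-- Aggregation functions on finite multisets of vectors. -/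
inductive Agg where
  | mean | sum | max
deriving DecidableEq

noncomputable def Agg.eval {d : ℕ} : Agg → Multiset (Fin d → ℚ) → Fin d → ℚ
  | .mean, s => fun i => (s.map (fun f => f i)).sum / (Multiset.card s : ℚ)
  | .sum, s => fun i => (s.map (fun f => f i)).sum
  | .max, s => fun i => ((s.map (fun f => f i)).toList).foldr Max.max 0

/-- One MPNN layer: a combination function (an FNN applied to the previous
state and the three aggregated messages) together with the choice of the two
local and the global aggregation functions. -/
structure MPNNLayer (din dout : ℕ) where
  comb : FNN (din + din + din + din) dout
  locIn : Agg
  locOut : Agg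
  glob : Agg

noncomputable def MPNNLayer.step {k din dout : ℕ} (l : MPNNLayer din dout) (G : Graph k)
    (x : Fin G.n → Fin din → ℚ) : Fin G.n → Fin dout → ℚ :=
  fun v => l.comb.eval
    (Fin.append (Fin.append (Fin.append (x v)
      (l.locIn.eval ((G.neighIn v).val.map x)))
      (l.locOut.eval ((G.neighOut v).val.map x)))
      (l.glob.eval ((Finset.univ : Finset (Fin G.n)).val.map x)))

/-- A message passing neural network: `L` layers with state dimensions
`dims 0, dims 1, …, dims L`. -/
structure MPNN where
  L : ℕ
  dims : ℕ → ℕ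
  layers : (i : ℕ) → MPNNLayer (dims i) (dims (i + 1))

/-- Initial state: the label of the node (padded with zeros if needed). -/
def Graph.init {k : ℕ} (G : Graph k) (d : ℕ) (v : Fin G.n) : Fin d → ℚ :=
  fun j => if h : (j : ℕ) < k then (if G.L v ⟨j, h⟩ then 1 else 0) else 0

/-- The state `x_v^{(i)}` computed by `M` on `G`. -/
noncomputable def MPNN.state {k : ℕ} (M : MPNN) (G : Graph k) : (i : ℕ) → Fin G.n → Fin (M.dims i) → ℚ
  | 0 => fun v => G.init (M.dims 0) v
  | i + 1 => (M.layers i).step G (M.state G i)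

/-- Last coordinate of a vector. -/
def lastVal {d : ℕ} (x : Fin d → ℚ) : ℚ :=
  if h : 0 < d then x ⟨d - 1, Nat.sub_lt h Nat.one_pos⟩ else 0

/-- The output `M(G,v)_⊥`: the last coordinate of the final state. -/
noncomputable def MPNN.out {k : ℕ} (M : MPNN) (G : Graph k) (v : Fin G.n) : ℚ :=
  lastVal (M.state G M.L v)

/-- All aggregations of `M` belong to the set `A`. -/
def MPNN.UsesAggs (M : MPNN) (A : Set Agg) : Prop :=
  ∀ i < M.L, (M.layers i).locIn ∈ A ∧ (M.layers i).locOut ∈ A ∧ (M.layers i).glob ∈ A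

/-- `M` belongs to the class `M_mean`. -/
def MPNN.IsMean (M : MPNN) : Prop := M.UsesAggs {Agg.mean}

/-- `M` recognises `φ` over the class `Cls` with certainty `c(|V|)`. -/
def Recognises {k : ℕ} (M : MPNN) (φ : PML k)
    (Cls : (G : Graph k) → Fin G.n → Prop) (c : ℕ → ℚ) : Prop :=
  ∀ (G : Graph k) (v : Fin G.n), Cls G v →
    (PML.sat G φ v = true → M.out G v = c G.n) ∧
    (PML.sat G φ v = false → M.out G v = 0)

end PMLMPNN
namespace PMLMPNN


/-! ### Piecewise linear functions are computed by FNNs -/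

inductive PL (a : ℕ) : ((Fin a → ℚ) → ℚ) → Prop
  | coord (i : Fin a) : PL a (fun x => x i)
  | const (q : ℚ) : PL a (fun _ => q)
  | add {f g : (Fin a → ℚ) → ℚ} : PL a f → PL a g → PL a (fun x => f x + g x)
  | smul {f : (Fin a → ℚ) → ℚ} (q : ℚ) : PL a f → PL a (fun x => q * f x)
  | relu {f : (Fin a → ℚ) → ℚ} : PL a f → PL a (fun x => max 0 (f x))

theorem FNN.eval_nonneg : ∀ {a b : ℕ} (N : FNN a b) (x : Fin a → ℚ) (j : Fin b), 0 ≤ N.eval x j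
  | _, _, .layer w b, x, j => by simp [FNN.eval]
  | _, _, .comp f g, x, j => by
    simp only [FNN.eval]
    exact FNN.eval_nonneg g _ j

def RO {a h : ℕ} (N : FNN a h) (f : (Fin a → ℚ) → ℚ) : Prop :=
  ∃ (b : ℚ) (w : Fin h → ℚ), ∀ x, f x = b + ∑ i, w i * N.eval x i

theorem RO.ext_relu {a h : ℕ} {N : FNN a h} {f : (Fin a → ℚ) → ℚ} (hf : RO N f) :
    ∃ (h' : ℕ) (N' : FNN a h'), (∀ g, RO N g → RO N' g) ∧ RO N' (fun x => max 0 (f x)) := by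
  obtain ⟨b, w, hw⟩ := hf
  let l : FNN h (h + 1) := .layer (Fin.cons w (fun i => Pi.single i 1)) (Fin.cons b (fun _ => 0))
  have h0 : ∀ x, (FNN.comp N l).eval x 0 = max 0 (f x) := by
    intro x
    simp [FNN.eval, l, hw]
  have hs : ∀ x i, (FNN.comp N l).eval x (Fin.succ i) = N.eval x i := by
    intro x i
    have := N.eval_nonneg x i
    simp [FNN.eval, l, Pi.single_apply, this]
  refine ⟨h + 1, .comp N l, ?_, ?_⟩
  · rintro g ⟨b', w', hg⟩
    refine ⟨b', Fin.cons 0 w', fun x => ?_⟩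
    rw [hg, Fin.sum_univ_succ]
    simp [hs]
  · refine ⟨0, Fin.cons 1 (fun _ => 0), fun x => ?_⟩
    rw [Fin.sum_univ_succ]
    simp [h0]

theorem RO.add {a h : ℕ} {N : FNN a h} {f g : (Fin a → ℚ) → ℚ} (hf : RO N f) (hg : RO N g) :
    RO N (fun x => f x + g x) := by
  obtain ⟨b, w, hw⟩ := hf
  obtain ⟨b', w', hw'⟩ := hg
  refine ⟨b + b', fun i => w i + w' i, fun x => ?_⟩
  simp only [hw, hw', add_mul, Finset.sum_add_distrib]
  ring

theorem RO.smul {a h : ℕ} {N : FNN a h} {f : (Fin a → ℚ) → ℚ} (q : ℚ) (hf : RO N f) :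
    RO N (fun x => q * f x) := by
  obtain ⟨b, w, hw⟩ := hf
  refine ⟨q * b, fun i => q * w i, fun x => ?_⟩
  simp only [hw, mul_add, Finset.mul_sum, mul_assoc]

theorem PL.ext {a : ℕ} {f : (Fin a → ℚ) → ℚ} (hf : PL a f) :
    ∀ (h : ℕ) (N : FNN a h), (∀ i, RO N (fun x => x i)) →
      ∃ (h' : ℕ) (N' : FNN a h'), (∀ g, RO N g → RO N' g) ∧ RO N' f := by
  induction hf with
  | coord i => exact fun h N hN => ⟨h, N, fun _ hg => hg, hN i⟩
  | const q => exact fun h N hN => ⟨h, N, fun _ hg => hg, q, fun _ => 0, by simp⟩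
  | add _ _ ih1 ih2 =>
    intro h N hN
    obtain ⟨h1, N1, e1, r1⟩ := ih1 h N hN
    obtain ⟨h2, N2, e2, r2⟩ := ih2 h1 N1 (fun i => e1 _ (hN i))
    exact ⟨h2, N2, fun g hg => e2 _ (e1 _ hg), (e2 _ r1).add r2⟩
  | smul q _ ih =>
    intro h N hN
    obtain ⟨h1, N1, e1, r1⟩ := ih h N hN
    exact ⟨h1, N1, e1, r1.smul q⟩
  | relu _ ih =>
    intro h N hN
    obtain ⟨h1, N1, e1, r1⟩ := ih h N hN
    obtain ⟨h2, N2, e2, r2⟩ := r1.ext_relu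
    exact ⟨h2, N2, fun g hg => e2 _ (e1 _ hg), r2⟩

theorem exists_id_FNN (a : ℕ) : ∃ (h : ℕ) (N : FNN a h), ∀ i, RO N (fun x => x i) := by
  refine ⟨a + a, .layer (Fin.append (fun i => Pi.single i 1) (fun i => Pi.single i (-1)))
    (fun _ => 0), fun i => ⟨0, Fin.append (Pi.single i 1) (Pi.single i (-1)), fun x => ?_⟩⟩
  rw [Fin.sum_univ_add]
  simp only [FNN.eval, Fin.append_left, Fin.append_right, Pi.single_apply, ite_mul, one_mul,
    zero_mul, neg_mul, zero_add, Finset.sum_ite_eq, Finset.sum_ite_eq', Finset.mem_univ, if_true]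
  rcases le_total 0 (x i) with h | h
  · rw [max_eq_right h, max_eq_left (by linarith)]; ring
  · rw [max_eq_left h, max_eq_right (by linarith)]; ring

theorem PL.family {a : ℕ} : ∀ (m : ℕ) (f : Fin m → (Fin a → ℚ) → ℚ), (∀ j, PL a (f j)) →
    ∃ (h : ℕ) (N : FNN a h), (∀ i, RO N (fun x => x i)) ∧ ∀ j, RO N (f j)
  | 0, f, _ => by
    obtain ⟨h, N, hN⟩ := exists_id_FNN a
    exact ⟨h, N, hN, fun j => j.elim0⟩
  | m + 1, f, hf => by
    obtain ⟨h, N, hN, hj⟩ := PL.family m (fun j => f j.succ) (fun j => hf _)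
    obtain ⟨h', N', e, r⟩ := (hf 0).ext h N hN
    exact ⟨h', N', fun i => e _ (hN i), fun j => Fin.cases r (fun j => e _ (hj j)) j⟩

theorem PL.exists_FNN {a m : ℕ} (f : Fin m → (Fin a → ℚ) → ℚ) (hf : ∀ j, PL a (f j)) :
    ∃ N : FNN a m, ∀ x j, N.eval x j = max 0 (f j x) := by
  obtain ⟨h, N, -, hN⟩ := PL.family m f hf
  choose b w hw using hN
  exact ⟨.comp N (.layer w b), fun x j => by simp [FNN.eval, hw]⟩

/-! ### Building MPNNs layer by layer -/

abbrev Fn (k : ℕ) := (G : Graph k) → Fin G.n → ℚ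

def mean {k : ℕ} (π : Modality) (f : Fn k) : Fn k := fun G v =>
  (∑ u ∈ G.modSem v π, f G u) / ((G.modSem v π).card : ℚ)

def meanLayer {d d' : ℕ} (N : FNN (d + d + d + d) d') : MPNNLayer d d' := ⟨N, .mean, .mean, .mean⟩

inductive Comp (k : ℕ) : ℕ → (d : ℕ) → ((G : Graph k) → Fin G.n → Fin d → ℚ) → Prop
  | base : Comp k 0 k (fun G => G.init k)
  | step {L d d' : ℕ} {F : (G : Graph k) → Fin G.n → Fin d → ℚ} (N : FNN (d + d + d + d) d') :
      Comp k L d F → Comp k (L + 1) d' (fun G => (meanLayer N).step G (F G))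

noncomputable def runFrom {k : ℕ} (M : MPNN) (G : Graph k) (x : Fin G.n → Fin (M.dims 0) → ℚ) :
    (i : ℕ) → Fin G.n → Fin (M.dims i) → ℚ
  | 0 => x
  | i + 1 => (M.layers i).step G (runFrom M G x i)

theorem state_eq_runFrom {k : ℕ} (M : MPNN) (G : Graph k) (i : ℕ) :
    M.state G i = runFrom M G (G.init _) i := by
  induction i with
  | zero => rfl
  | succ i ih => simp only [MPNN.state, runFrom, ih]

def consDims (d : ℕ) (f : ℕ → ℕ) : ℕ → ℕ
  | 0 => d
  | i + 1 => f i

def consLayers {d : ℕ} (M : MPNN) (l : MPNNLayer d (M.dims 0)) :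
    (i : ℕ) → MPNNLayer (consDims d M.dims i) (consDims d M.dims (i + 1))
  | 0 => l
  | i + 1 => M.layers i

def consM {d : ℕ} (M : MPNN) (l : MPNNLayer d (M.dims 0)) : MPNN :=
  ⟨M.L + 1, consDims d M.dims, consLayers M l⟩

theorem runFrom_consM {k d : ℕ} (M : MPNN) (l : MPNNLayer d (M.dims 0)) (G : Graph k)
    (x : Fin G.n → Fin d → ℚ) (i : ℕ) :
    runFrom (consM M l) G x (i + 1) = runFrom M G (l.step G x) i := by
  induction i with
  | zero => rfl
  | succ i ih =>
    change (M.layers i).step G (runFrom (consM M l) G x (i + 1)) = _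
    exact congrArg ((M.layers i).step G) ih

theorem Comp.exists_MPNN {k L d : ℕ} {F : (G : Graph k) → Fin G.n → Fin d → ℚ}
    (h : Comp k L d F) : ∀ (M : MPNN) (hd : d = M.dims 0), M.IsMean →
      ∃ M' : MPNN, M'.IsMean ∧ M'.dims 0 = k ∧ M'.L = L + M.L ∧
        ∀ G v, M'.out G v = lastVal (runFrom M G (fun u j => F G u (Fin.cast hd.symm j)) M.L v) := by
  induction h with
  | base =>
    intro M hd hM
    refine ⟨M, hM, hd.symm, by simp, fun G v => ?_⟩
    rw [MPNN.out, state_eq_runFrom]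
    rfl
  | @step L d d' F N hF ih =>
    intro M hd hM
    subst hd
    obtain ⟨M', h1, h2, h3, h4⟩ := ih (consM M (meanLayer N)) rfl (by
      rintro (_ | i) hi
      · simp [consM, consLayers, meanLayer]
      · exact hM i (by simpa [consM] using hi))
    refine ⟨M', h1, h2, by rw [h3]; simp [consM]; ring, fun G v => ?_⟩
    rw [h4]
    have := runFrom_consM M (meanLayer N) G (F G) M.L
    exact congrArg lastVal (congrFun this v)

/-- input of the combination function -/
noncomputable def inp {k d : ℕ} (F : (G : Graph k) → Fin G.n → Fin d → ℚ) (G : Graph k)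
    (v : Fin G.n) : Fin (d + d + d + d) → ℚ :=
  (Fin.append (Fin.append (Fin.append (F G v)
      (Agg.mean.eval ((G.neighIn v).val.map (F G))))
      (Agg.mean.eval ((G.neighOut v).val.map (F G))))
      (Agg.mean.eval ((Finset.univ : Finset (Fin G.n)).val.map (F G))))

theorem inp_coord {k d : ℕ} (F : (G : Graph k) → Fin G.n → Fin d → ℚ) (π : Modality) (j : Fin d) :
    ∃ i, ∀ G v, inp F G v i = mean π (fun G u => F G u j) G v := by
  cases π with
  | id =>
    refine ⟨Fin.castAdd d (Fin.castAdd d (Fin.castAdd d j)), fun G v => ?_⟩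
    simp [inp, mean, Graph.modSem]
  | ein =>
    refine ⟨Fin.castAdd d (Fin.castAdd d (Fin.natAdd d j)), fun G v => ?_⟩
    simp only [inp, mean, Graph.modSem, Agg.eval, Fin.append_left, Fin.append_right,
      Multiset.map_map, Multiset.card_map]
    rfl
  | eout =>
    refine ⟨Fin.castAdd d (Fin.natAdd (d + d) j), fun G v => ?_⟩
    simp only [inp, mean, Graph.modSem, Agg.eval, Fin.append_left, Fin.append_right,
      Multiset.map_map, Multiset.card_map]
    rfl
  | top =>
    refine ⟨Fin.natAdd (d + d + d) j, fun G v => ?_⟩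
    simp only [inp, mean, Graph.modSem, Agg.eval, Fin.append_left, Fin.append_right,
      Multiset.map_map, Multiset.card_map]
    rfl

def InE {k d : ℕ} (F : (G : Graph k) → Fin G.n → Fin d → ℚ) (f : Fn k) : Prop :=
  ∃ g, PL (d + d + d + d) g ∧ ∀ G v, f G v = g (inp F G v)

theorem Comp.family {k L d m : ℕ} {F : (G : Graph k) → Fin G.n → Fin d → ℚ}
    (h : Comp k L d F) (f : Fin m → Fn k) (hf : ∀ j, InE F (f j)) :
    Comp k (L + 1) m (fun G v j => max 0 (f j G v)) := by
  choose g hg hfg using hf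
  obtain ⟨N, hN⟩ := PL.exists_FNN g hg
  have : (fun G v j => max 0 (f j G v)) = fun G => (meanLayer N).step G (F G) := by
    funext G v j
    rw [hfg, ← hN]
    rfl
  rw [this]
  exact .step N h

/-! ### Features -/

inductive Feat (k : ℕ) : ℕ → Fn k → Prop
  | lab (L : ℕ) (i : Fin k) : Feat k L (fun G v => if G.L v i then 1 else 0)
  | const (L : ℕ) (q : ℚ) : Feat k L (fun _ _ => q)
  | add {L : ℕ} {f g : Fn k} : Feat k L f → Feat k L g → Feat k L (fun G v => f G v + g G v)
  | smul {L : ℕ} {f : Fn k} (q : ℚ) : Feat k L f → Feat k L (fun G v => q * f G v)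
  | relu {L : ℕ} {f : Fn k} : Feat k L f → Feat k L (fun G v => max 0 (f G v))
  | agg {L : ℕ} {f : Fn k} (π : Modality) : Feat k L f →
      Feat k (L + 1) (mean π (fun G v => max 0 (f G v)))

theorem Feat.succ {k L : ℕ} {f : Fn k} (h : Feat k L f) : Feat k (L + 1) f := by
  induction h with
  | lab L i => exact .lab _ i
  | const L q => exact .const _ q
  | add _ _ h1 h2 => exact .add h1 h2
  | smul q _ h => exact .smul q h
  | relu _ h => exact .relu h
  | agg π _ h => exact .agg π h

theorem Feat.mono {k L L' : ℕ} {f : Fn k} (h : Feat k L f) (hL : L ≤ L') : Feat k L' f := by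
  induction hL with
  | refl => exact h
  | step _ ih => exact ih.succ

theorem InE.add {k d : ℕ} {F : (G : Graph k) → Fin G.n → Fin d → ℚ} {f g : Fn k}
    (hf : InE F f) (hg : InE F g) : InE F (fun G v => f G v + g G v) := by
  obtain ⟨f', hf, h1⟩ := hf
  obtain ⟨g', hg, h2⟩ := hg
  exact ⟨_, hf.add hg, fun G v => by simp only [h1, h2]⟩

theorem InE.smul {k d : ℕ} {F : (G : Graph k) → Fin G.n → Fin d → ℚ} {f : Fn k} (q : ℚ)
    (hf : InE F f) : InE F (fun G v => q * f G v) := by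
  obtain ⟨f', hf, h1⟩ := hf
  exact ⟨_, hf.smul q, fun G v => by simp only [h1]⟩

theorem InE.relu {k d : ℕ} {F : (G : Graph k) → Fin G.n → Fin d → ℚ} {f : Fn k}
    (hf : InE F f) : InE F (fun G v => max 0 (f G v)) := by
  obtain ⟨f', hf, h1⟩ := hf
  exact ⟨_, hf.relu, fun G v => by simp only [h1]⟩

theorem InE.const {k d : ℕ} {F : (G : Graph k) → Fin G.n → Fin d → ℚ} (q : ℚ) :
    InE F (fun _ _ => q) := ⟨_, .const q, fun _ _ => rfl⟩

theorem InE.mean {k d : ℕ} {F : (G : Graph k) → Fin G.n → Fin d → ℚ} (π : Modality) (j : Fin d) :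
    InE F (mean π (fun G u => F G u j)) := by
  obtain ⟨i, hi⟩ := inp_coord F π j
  exact ⟨_, .coord i, fun G v => by rw [hi]⟩

theorem mean_id {k : ℕ} (f : Fn k) : mean .id f = f := by
  funext G v
  simp [mean, Graph.modSem]

theorem Feat.inE_zero {k L : ℕ} {f : Fn k} (h : Feat k L f) (hL : L = 0) :
    InE (fun G : Graph k => G.init k) f := by
  induction h with
  | lab L i =>
    have := InE.mean (F := fun G : Graph k => G.init k) .id i
    rw [mean_id] at this
    simpa [Graph.init] using this
  | const L q => exact .const q
  | add _ _ h1 h2 => exact (h1 hL).add (h2 hL)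
  | smul q _ h => exact (h hL).smul q
  | relu _ h => exact (h hL).relu
  | agg π _ h => omega

theorem Feat.inE_succ {k L' : ℕ} {f : Fn k} (h : Feat k L' f) (L : ℕ) (hL : L' = L + 1) :
    ∃ S : Set (Fn k), S.Finite ∧ (∀ g ∈ S, Feat k L g) ∧
      ∀ (d : ℕ) (g : Fin d → Fn k), S ⊆ Set.range g →
        InE (fun G v j => max 0 (g j G v)) f := by
  induction h with
  | lab L' i =>
    refine ⟨{fun G v => if G.L v i then 1 else 0}, Set.finite_singleton _, ?_, ?_⟩
    · rintro g rfl
      exact .lab _ i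
    · intro d g hg
      obtain ⟨j, hj⟩ := hg rfl
      have := InE.mean (F := fun G v j => max 0 (g j G v)) .id j
      rw [mean_id] at this
      simp only [hj] at this
      convert this using 3 with G v
      split_ifs <;> simp
  | const L q => exact ⟨∅, Set.finite_empty, by simp, fun d g _ => .const q⟩
  | add _ _ h1 h2 =>
    obtain ⟨S1, f1, a1, b1⟩ := h1 hL
    obtain ⟨S2, f2, a2, b2⟩ := h2 hL
    refine ⟨S1 ∪ S2, f1.union f2, ?_, fun d g hg => ?_⟩
    · rintro g (hg | hg)
      · exact a1 _ hg
      · exact a2 _ hg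
    · exact (b1 d g (Set.subset_union_left.trans hg)).add (b2 d g (Set.subset_union_right.trans hg))
  | smul q _ h =>
    obtain ⟨S, a, b, c⟩ := h hL
    exact ⟨S, a, b, fun d g hg => (c d g hg).smul q⟩
  | relu _ h =>
    obtain ⟨S, a, b, c⟩ := h hL
    exact ⟨S, a, b, fun d g hg => (c d g hg).relu⟩
  | @agg L' f π hf h =>
    obtain rfl : L' = L := by omega
    refine ⟨{f}, Set.finite_singleton _, ?_, ?_⟩
    · rintro g rfl
      exact hf
    · intro d g hg
      obtain ⟨j, hj⟩ := hg rfl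
      have := InE.mean (F := fun G v j => max 0 (g j G v)) π j
      simpa only [hj] using this

theorem Feat.comp {k : ℕ} : ∀ (L m : ℕ) (f : Fin m → Fn k), (∀ j, Feat k L (f j)) →
    Comp k (L + 1) m (fun G v j => max 0 (f j G v))
  | 0, m, f, hf => Comp.base.family f (fun j => (hf j).inE_zero rfl)
  | L + 1, m, f, hf => by
    choose S hS1 hS2 hS3 using fun j => (hf j).inE_succ L rfl
    have hfin : (⋃ j, S j).Finite := Set.finite_iUnion hS1
    obtain ⟨d, g, hg⟩ : ∃ (d : ℕ) (g : Fin d → Fn k), Set.range g = ⋃ j, S j := by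
      obtain ⟨d, g, -, hg⟩ := hfin.fin_param
      exact ⟨d, g, hg⟩
    refine (Feat.comp L d g ?_).family f ?_
    · intro j
      have : g j ∈ ⋃ j, S j := hg ▸ Set.mem_range_self j
      obtain ⟨i, hi⟩ := Set.mem_iUnion.1 this
      exact hS2 i _ hi
    · intro j
      exact hS3 j d g (hg ▸ Set.subset_iUnion S j)

theorem Feat.exists_MPNN {k L : ℕ} {f : Fn k} (h : Feat k L f) :
    ∃ M : MPNN, M.IsMean ∧ M.dims 0 = k ∧ M.L = L + 1 ∧ ∀ G v, M.out G v = max 0 (f G v) := by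
  obtain ⟨M, h1, h2, h3, h4⟩ := (Feat.comp L 1 (fun _ => f) (fun _ => h)).exists_MPNN
    ⟨0, fun _ => 1, fun _ => meanLayer (.layer (fun _ _ => 0) (fun _ => 0))⟩ rfl
    (fun i hi => absurd hi (by simp))
  refine ⟨M, h1, h2, h3, fun G v => ?_⟩
  rw [h4]
  simp [lastVal, runFrom]

/-! ### Values known to all nodes, and values known at the focus -/

section
variable {k : ℕ} (p : Fin k)

def BV (L : ℕ) (val : Fn k) : Prop :=
  ∃ f, Feat k L f ∧ ∀ G v, Graph.StronglyMarkedBy G v p →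
    (∀ u, f G u = val G v) ∧ 0 ≤ val G v ∧ val G v ≤ 1

def WV (L : ℕ) (val : Fn k) : Prop :=
  ∃ f, Feat k L f ∧ ∀ G v, Graph.StronglyMarkedBy G v p → f G v = val G v

variable {p}

theorem BV.wv {L : ℕ} {val : Fn k} (h : BV p L val) : WV p L val := by
  obtain ⟨f, hf, h⟩ := h
  exact ⟨f, hf, fun G v hv => (h G v hv).1 v⟩

theorem BV.congr {L : ℕ} {val val' : Fn k} (h : BV p L val)
    (h' : ∀ G v, Graph.StronglyMarkedBy G v p → val G v = val' G v) : BV p L val' := by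
  obtain ⟨f, hf, h⟩ := h
  refine ⟨f, hf, fun G v hv => ?_⟩
  rw [← h' G v hv]
  exact h G v hv

theorem WV.congr {L : ℕ} {val val' : Fn k} (h : WV p L val)
    (h' : ∀ G v, Graph.StronglyMarkedBy G v p → val G v = val' G v) : WV p L val' := by
  obtain ⟨f, hf, h⟩ := h
  exact ⟨f, hf, fun G v hv => by rw [← h' G v hv, h G v hv]⟩

theorem WV.const (L : ℕ) (q : ℚ) : WV p L (fun _ _ => q) := ⟨_, .const L q, fun _ _ _ => rfl⟩

theorem WV.add {L : ℕ} {f g : Fn k} (hf : WV p L f) (hg : WV p L g) :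
    WV p L (fun G v => f G v + g G v) := by
  obtain ⟨f', hf, h1⟩ := hf
  obtain ⟨g', hg, h2⟩ := hg
  exact ⟨_, hf.add hg, fun G v hv => by rw [h1 G v hv, h2 G v hv]⟩

theorem WV.smul {L : ℕ} {f : Fn k} (q : ℚ) (hf : WV p L f) :
    WV p L (fun G v => q * f G v) := by
  obtain ⟨f', hf, h1⟩ := hf
  exact ⟨_, hf.smul q, fun G v hv => by rw [h1 G v hv]⟩

theorem WV.relu {L : ℕ} {f : Fn k} (hf : WV p L f) :
    WV p L (fun G v => max 0 (f G v)) := by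
  obtain ⟨f', hf, h1⟩ := hf
  exact ⟨_, hf.relu, fun G v hv => by rw [h1 G v hv]⟩

theorem WV.sub {L : ℕ} {f g : Fn k} (hf : WV p L f) (hg : WV p L g) :
    WV p L (fun G v => f G v - g G v) :=
  (hf.add (hg.smul (-1))).congr fun G v _ => by ring

theorem WV.min {L : ℕ} {f g : Fn k} (hf : WV p L f) (hg : WV p L g) :
    WV p L (fun G v => min (f G v) (g G v)) :=
  (hf.sub (hf.sub hg).relu).congr fun G v _ => by
    rcases le_total (f G v) (g G v) with h | h
    · rw [min_eq_left h, max_eq_left (by linarith)]; ring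
    · rw [min_eq_right h, max_eq_right (by linarith)]; ring

theorem WV.sum {L : ℕ} {ι : Type*} (s : Finset ι) (f : ι → Fn k) (hf : ∀ i ∈ s, WV p L (f i)) :
    WV p L (fun G v => ∑ i ∈ s, f i G v) := by
  classical
  induction s using Finset.induction_on with
  | empty => simpa using WV.const (p := p) L 0
  | insert i s hi ih =>
    refine ((hf i (by simp)).add (ih fun j hj => hf j (by simp [hj]))).congr fun G v _ => ?_
    rw [Finset.sum_insert hi]

/-- Broadcast a value known at the focus. -/
theorem bcast {L : ℕ} {f : Fn k} (hf : Feat k L f) (h : ∀ G v, Graph.StronglyMarkedBy G v p →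
      0 ≤ f G v ∧ ∀ u, f G u ≤ 1) :
    BV p (L + 1) (fun G v => f G v / G.n) := by
  refine ⟨_, .agg .top ((hf.add (.lab L p)).add (.const L (-1))), fun G v hv => ⟨fun u => ?_, ?_⟩⟩
  · have h1 := h G v hv
    have : ∀ w, max 0 ((f G w + if G.L w p then 1 else 0) + -1) = if w = v then f G v else 0 := by
      intro w
      by_cases hw : w = v
      · subst hw
        simp [(hv.1 w).2 rfl, h1.1]
      · have : ¬ G.L w p = true := fun h => hw ((hv.1 w).1 h)
        simp only [this, hw, if_false]
        have := h1.2 w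
        rw [max_eq_left]
        simp [this]
    simp only [mean, this, Graph.modSem]
    simp
  · have h1 := h G v hv
    have hn : (1 : ℚ) ≤ G.n := by exact_mod_cast v.pos
    have := h1.2 v
    refine ⟨div_nonneg h1.1 (by linarith), ?_⟩
    rw [div_le_one (by linarith)]
    linarith

theorem BV.divn {L : ℕ} {val : Fn k} (h : BV p L val) : BV p (L + 1) (fun G v => val G v / G.n) := by
  obtain ⟨f, hf, h⟩ := h
  refine (bcast (p := p) hf fun G v hv => ?_).congr fun G v hv => ?_
  · obtain ⟨a, b, c⟩ := h G v hv
    exact ⟨by rw [a]; exact b, fun u => by rw [a]; exact c⟩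
  · rw [(h G v hv).1]

theorem BV.one (L : ℕ) : BV p L (fun _ _ => 1) :=
  ⟨_, .const L 1, fun _ _ _ => ⟨fun _ => rfl, by norm_num, le_refl _⟩⟩

theorem BV.pow (e : ℕ) : BV p e (fun G _ => 1 / (G.n : ℚ) ^ e) := by
  induction e with
  | zero => simpa using BV.one (p := p) 0
  | succ e ih =>
    refine ih.divn.congr fun G v _ => ?_
    rw [pow_succ, div_div]

theorem mean_le {π : Modality} {f : Fn k} {G : Graph k} (v : Fin G.n) {c : ℚ} (hc : 0 ≤ c)
    (h : ∀ u, f G u ≤ c) : mean π f G v ≤ c := by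
  rw [mean]
  apply div_le_of_le_mul₀ (by positivity) hc
  calc _ ≤ ∑ u ∈ G.modSem v π, c := Finset.sum_le_sum fun u _ => h u
    _ = _ := by simp [mul_comm]

/-- Boolean features. -/
def BoolFeat (χ : (G : Graph k) → Fin G.n → Bool) : Prop :=
  Feat k 0 (fun G v => if χ G v then 1 else 0)

def cnt (π : Modality) (χ : (G : Graph k) → Fin G.n → Bool) (G : Graph k) (v : Fin G.n) : ℕ :=
  ((G.modSem v π).filter (fun u => χ G u = true)).card

def dg (π : Modality) (G : Graph k) (v : Fin G.n) : ℕ := (G.modSem v π).card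

theorem BV.mul {L : ℕ} {val : Fn k} (h : BV p L val) (π : Modality)
    {χ : (G : Graph k) → Fin G.n → Bool} (hχ : BoolFeat χ) :
    BV p (L + 2) (fun G v => val G v * (cnt π χ G v / (G.n * dg π G v))) := by
  obtain ⟨f, hf, h⟩ := h
  have key : ∀ G v, Graph.StronglyMarkedBy G v p → ∀ u,
      max 0 ((f G u + if χ G u then 1 else 0) + -1) = if χ G u then val G v else 0 := by
    intro G v hv u
    obtain ⟨a, b, c⟩ := h G v hv
    rw [a]
    split_ifs
    · rw [max_eq_right] <;> linarith
    · rw [max_eq_left]; linarith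
  refine (bcast (p := p) (.agg π ((hf.add (Feat.mono hχ (Nat.zero_le L))).add (.const L (-1))))
    fun G v hv => ⟨?_, fun u => ?_⟩).congr fun G v hv => ?_
  · exact div_nonneg (Finset.sum_nonneg fun u _ => le_max_left _ _) (by positivity)
  · obtain ⟨a, b, c⟩ := h G v hv
    apply mean_le _ zero_le_one
    intro u
    rw [key G v hv]
    split_ifs <;> linarith
  · simp only [mean, key G v hv]
    rw [← Finset.sum_filter, Finset.sum_const, nsmul_eq_mul]
    simp only [cnt, dg]
    rw [div_div, mul_comm (G.n : ℚ), mul_comm (val G v), div_mul_eq_mul_div]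

theorem boolFeat_lab (i : Fin k) : BoolFeat (fun G v => G.L v i) := .lab 0 i

theorem cnt_mark {G : Graph k} {v : Fin G.n} (hv : G.StronglyMarkedBy v p) {π : Modality}
    (hπ : v ∈ G.modSem v π) : cnt π (fun G v => G.L v p) G v = 1 := by
  rw [cnt, Finset.card_eq_one]
  refine ⟨v, ?_⟩
  ext u
  simp only [Finset.mem_filter, Finset.mem_singleton]
  constructor
  · rintro ⟨_, h⟩
    exact (hv.1 u).1 h
  · rintro rfl
    exact ⟨hπ, (hv.1 u).2 rfl⟩

def Q (G : Graph k) (v : Fin G.n) : ℚ := (G.n * dg .ein G v) * (G.n * dg .eout G v)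

theorem mem_ein {G : Graph k} {v : Fin G.n} (hv : G.StronglyMarkedBy v p) :
    v ∈ G.modSem v .ein := by simp [Graph.modSem, Graph.neighIn, hv.2]

theorem mem_eout {G : Graph k} {v : Fin G.n} (hv : G.StronglyMarkedBy v p) :
    v ∈ G.modSem v .eout := by simp [Graph.modSem, Graph.neighOut, hv.2]

theorem Q_bounds {G : Graph k} {v : Fin G.n} (hv : G.StronglyMarkedBy v p) :
    1 ≤ Q G v ∧ Q G v ≤ (G.n : ℚ) ^ 4 := by
  have h1 : 1 ≤ dg .ein G v := Finset.card_pos.2 ⟨v, mem_ein hv⟩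
  have h2 : 1 ≤ dg .eout G v := Finset.card_pos.2 ⟨v, mem_eout hv⟩
  have h3 : dg .ein G v ≤ G.n := (Finset.card_le_univ _).trans (by simp)
  have h4 : dg .eout G v ≤ G.n := (Finset.card_le_univ _).trans (by simp)
  have hn : 1 ≤ G.n := v.pos
  have : Q G v = (((G.n * dg .ein G v) * (G.n * dg .eout G v) : ℕ) : ℚ) := by
    simp [Q]
  rw [this]
  constructor
  · have : 1 ≤ (G.n * dg .ein G v) * (G.n * dg .eout G v) := by
      apply Nat.one_le_iff_ne_zero.2
      positivity
    exact_mod_cast this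
  · have : (G.n * dg .ein G v) * (G.n * dg .eout G v) ≤ (G.n * G.n) * (G.n * G.n) := by gcongr
    calc _ ≤ (((G.n * G.n) * (G.n * G.n) : ℕ) : ℚ) := by exact_mod_cast this
      _ = _ := by push_cast; ring

theorem BV.mulE {L : ℕ} {val : Fn k} (h : BV p L val) {π : Modality}
    (hπ : π = .ein ∨ π = .eout) {χ : (G : Graph k) → Fin G.n → Bool} (hχ : BoolFeat χ) :
    BV p (L + 4) (fun G v => val G v * (cnt π χ G v / Q G v)) := by
  rcases hπ with rfl | rfl
  · refine ((h.mul .ein hχ).mul .eout (boolFeat_lab p)).congr fun G v hv => ?_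
    rw [cnt_mark hv (mem_eout hv), Q, mul_assoc, div_mul_div_comm]
    simp
  · refine ((h.mul .eout hχ).mul .ein (boolFeat_lab p)).congr fun G v hv => ?_
    rw [cnt_mark hv (mem_ein hv), Q, mul_assoc, div_mul_div_comm]
    simp [mul_comm]

theorem BV.mon {m : ℕ} {π : Fin m → Modality} (hπ : ∀ i, π i = .ein ∨ π i = .eout)
    {χ : Fin m → (G : Graph k) → Fin G.n → Bool} (hχ : ∀ i, BoolFeat (χ i)) :
    ∀ (D : ℕ) (l : List (Fin m)), l.length ≤ D →
      BV p (4 * D) (fun G v => (monValZ (fun i => cnt (π i) (χ i) G v) l : ℚ) / Q G v ^ D)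
  | 0, l, hl => by
    obtain rfl : l = [] := List.length_eq_zero_iff.1 (by omega)
    simpa [monValZ] using BV.one (p := p) 0
  | D + 1, [], _ => by
    refine ((BV.mon hπ hχ D [] (by simp)).mulE (.inl rfl) (boolFeat_lab p)).congr fun G v hv => ?_
    rw [cnt_mark hv (mem_ein hv), div_mul_div_comm, ← pow_succ]
    simp
  | D + 1, j :: l, hl => by
    refine ((BV.mon hπ hχ D l (by simpa using hl)).mulE (hπ j) (hχ j)).congr fun G v hv => ?_
    rw [div_mul_div_comm, ← pow_succ]
    simp [monValZ, mul_comm]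

def bval (D : ℕ) (b : (G : Graph k) → Fin G.n → Bool) : Fn k :=
  fun G v => if b G v then 1 / Q G v ^ D else 0

theorem unit_WV (D : ℕ) : WV p (4 * D) (fun G v => 1 / Q G v ^ D) := by
  have := (BV.mon (p := p) (m := 0) (π := fun _ => .ein) (fun i => i.elim0)
    (χ := fun _ G v => true) (fun i => i.elim0) D [] (by simp)).wv
  simpa [monValZ] using this

theorem unit_pos {G : Graph k} {v : Fin G.n} (hv : G.StronglyMarkedBy v p) (D : ℕ) :
    0 < 1 / Q G v ^ D ∧ 1 / Q G v ^ D ≤ 1 := by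
  have h := (Q_bounds hv).1
  have : 1 ≤ Q G v ^ D := one_le_pow₀ h
  exact ⟨by positivity, by rw [div_le_one] <;> linarith⟩

theorem WV.bnot {D : ℕ} {b : (G : Graph k) → Fin G.n → Bool} (h : WV p (4 * D) (bval D b)) :
    WV p (4 * D) (bval D (fun G v => ! b G v)) :=
  ((unit_WV D).sub h).congr fun G v hv => by
    simp only [bval]
    by_cases hb : b G v = true <;> simp [hb]

theorem WV.band {D : ℕ} {b b' : (G : Graph k) → Fin G.n → Bool} (h : WV p (4 * D) (bval D b))
    (h' : WV p (4 * D) (bval D b')) :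
    WV p (4 * D) (bval D (fun G v => b G v && b' G v)) :=
  (((h.add h').sub (unit_WV D)).relu).congr fun G v hv => by
    have := (unit_pos hv D).1.le
    simp only [bval]
    generalize 1 / Q G v ^ D = t at *
    by_cases hb : b G v = true <;> by_cases hb' : b' G v = true <;> simp [hb, hb', this]

theorem WV.peano {m : ℕ} {π : Fin m → Modality} (hπ : ∀ i, π i = .ein ∨ π i = .eout)
    {χ : Fin m → (G : Graph k) → Fin G.n → Bool} (hχ : ∀ i, BoolFeat (χ i)) (D : ℕ)
    (ψ : PeanoFormula m) (hD : ψ.deg ≤ D) :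
    WV p (4 * D) (bval D (fun G v => ψ.sat (fun i => cnt (π i) (χ i) G v))) := by
  induction ψ with
  | not ψ ih => exact (ih hD).bnot
  | and ψ₁ ψ₂ ih1 ih2 =>
    exact (ih1 (le_trans (le_max_left _ _) hD)).band (ih2 (le_trans (le_max_right _ _) hD))
  | ineq t =>
    have hm : ∀ i, (t.mon i).length ≤ D := fun i =>
      (Finset.le_sup (f := fun i => (t.mon i).length) (Finset.mem_univ i)).trans hD
    have h1 := WV.sum (p := p) Finset.univ _ fun i _ =>
      ((BV.mon (p := p) hπ hχ D (t.mon i) (hm i)).wv.smul (t.a i : ℚ))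
    have h2 := ((((unit_WV (p := p) D).smul (t.b + 1 : ℚ)).sub h1).relu).min (unit_WV D)
    refine h2.congr fun G v hv => ?_
    have hu := (unit_pos hv D).1
    simp only [bval, PeanoFormula.sat, PeanoIneq.sat, decide_eq_true_eq]
    set P : ℤ := ∑ i, t.a i * monValZ (fun i => cnt (π i) (χ i) G v) (t.mon i) with hP
    have hs : ∑ i, (t.a i : ℚ) * ((monValZ (fun i => cnt (π i) (χ i) G v) (t.mon i) : ℚ)
        / Q G v ^ D) = P * (1 / Q G v ^ D) := by
      rw [hP]
      push_cast
      rw [Finset.sum_mul]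
      exact Finset.sum_congr rfl fun i _ => by ring
    rw [hs]
    generalize 1 / Q G v ^ D = s at *
    split_ifs with hle
    · have : (P : ℚ) ≤ t.b := by exact_mod_cast hle
      rw [min_eq_right]
      apply le_max_of_le_right
      nlinarith
    · have : (t.b + 1 : ℚ) ≤ P := by exact_mod_cast not_le.1 hle
      rw [max_eq_left (by nlinarith), min_eq_left hu.le]

theorem boolFeat_prop (φ : PML k) (h : φ.md = 0) : BoolFeat (fun G v => PML.sat G φ v) := by
  induction φ with
  | prop i => exact .lab 0 i
  | not φ ih =>
    have h1 : Feat k 0 _ := ih h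
    have := (Feat.const 0 1).add (h1.smul (-1))
    unfold BoolFeat
    convert this using 3 with G v
    simp only [PML.sat]
    by_cases hb : PML.sat G φ v = true <;> simp [hb]
  | and φ₁ φ₂ ih1 ih2 =>
    have hm : max φ₁.md φ₂.md = 0 := h
    have h1 : Feat k 0 _ := ih1 (by omega)
    have h2 : Feat k 0 _ := ih2 (by omega)
    have := ((h1.add h2).add (.const 0 (-1))).relu
    unfold BoolFeat
    convert this using 3 with G v
    simp only [PML.sat]
    by_cases hb : PML.sat G φ₁ v = true <;> by_cases hb' : PML.sat G φ₂ v = true <;> simp [hb, hb']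
  | modal m π ψ φs ih => simp [PML.md] at h

theorem WV.pml (D : ℕ) (φ : PML k) (hmd : φ.md ≤ 1) (hE : φ.onlyE) (hD : φ.deg ≤ D) :
    WV p (4 * D) (bval D (fun G v => PML.sat G φ v)) := by
  induction φ with
  | prop i =>
    have h1 : WV p (4 * D) (fun G v => if G.L v i then 1 else 0) := ⟨_, .lab _ i, fun _ _ _ => rfl⟩
    refine (((unit_WV D).add h1).add (.const _ (-1))).relu.congr fun G v hv => ?_
    have := unit_pos hv D
    simp only [bval, PML.sat]
    generalize 1 / Q G v ^ D = s at *
    by_cases hb : G.L v i = true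
    · simp [hb, this.1.le]
    · simp [hb, this.2]
  | not φ ih => exact (ih hmd hE hD).bnot
  | and φ₁ φ₂ ih1 ih2 =>
    exact (ih1 (le_trans (le_max_left _ _) hmd) hE.1 (le_trans (le_max_left _ _) hD)).band
      (ih2 (le_trans (le_max_right _ _) hmd) hE.2 (le_trans (le_max_right _ _) hD))
  | modal m π ψ φs ih =>
    have hmd' : ∀ i, (φs i).md = 0 := fun i => by
      have := Finset.le_sup (f := fun i => (φs i).md) (Finset.mem_univ i)
      simp only [PML.md] at hmd
      omega
    exact WV.peano hE.1 (χ := fun i G v => PML.sat G (φs i) v)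
      (fun i => boolFeat_prop _ (hmd' i)) D ψ (le_trans (le_max_left _ _) hD)

end

/-- for `A = {mean, sum}` or `A = {mean, max}` there is a
constant `C` such that every `φ ∈ PML₁^E` is recognised, over pointed graphs
whose focus is strongly marked by colour `p`, by an MPNN from `M_A` with at
most `C·(deg(φ)+1)` layers with certainty `1/|V|^e` for some
`e ≤ C·(deg(φ)+1)`. -/
theorem statement4 (A : Set Agg)
    (hA : A = {Agg.mean, Agg.sum} ∨ A = {Agg.mean, Agg.max}) :
    ∃ C : ℕ, ∀ (k : ℕ) (p : Fin k) (φ : PML k), φ.md ≤ 1 → φ.onlyE →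
      ∃ (M : MPNN) (e : ℕ), M.UsesAggs A ∧ M.dims 0 = k ∧
        M.L ≤ C * (φ.deg + 1) ∧ e ≤ C * (φ.deg + 1) ∧
        Recognises M φ (fun G v => G.StronglyMarkedBy v p)
          (fun n => 1 / (n : ℚ) ^ e) := by
  refine ⟨4, fun k p φ hmd hE => ?_⟩
  have hmean : Agg.mean ∈ A := by rcases hA with rfl | rfl <;> simp
  obtain ⟨f, hf, hfv⟩ := (WV.pml (p := p) φ.deg φ hmd hE le_rfl).min
    (BV.pow (p := p) (4 * φ.deg)).wv
  obtain ⟨M, h1, h2, h3, h4⟩ := hf.exists_MPNN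
  refine ⟨M, 4 * φ.deg, fun i hi => ?_, h2, by omega, by omega, fun G v hv => ?_⟩
  · obtain ⟨a, b, c⟩ := h1 i hi
    rw [Set.mem_singleton_iff] at a b c
    rw [a, b, c]
    exact ⟨hmean, hmean, hmean⟩
  · rw [h4, hfv G v hv]
    have hQ := Q_bounds hv
    have hn : (0 : ℚ) < G.n := by exact_mod_cast v.pos
    have hpos : 0 ≤ 1 / (G.n : ℚ) ^ (4 * φ.deg) := by positivity
    constructor
    · intro hs
      simp only [bval, hs, if_true]
      rw [min_eq_right, max_eq_right hpos]
      rw [pow_mul]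
      have : 0 < Q G v := by linarith
      exact one_div_le_one_div_of_le (by positivity) (pow_le_pow_left₀ this.le hQ.2 _)
    · intro hs
      simp only [bval, hs]
      simp

end PMLMPNN
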